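/- For every ε ∈ (0,1) there exist a probability space carrying a ℤ-invariant family of real random variables (p_x)_{x∈ℤ} and an independent random variable U uniform on [0,1), together with a constant c > 0, such that E[|p_0|^{2−ε}] < ∞ while Var[N_r] / (2r) ≥ c · r^{−1+ε/2} for all r ≥ 1, where N_r := ∑_{x∈ℤ} 1{ |x + p_x + U| ≤ r }. In particular the second-moment condition for class-I hyperuniformity in dimension 1 is sharp. -/

import Mathlib

open MeasureTheory ProbabilityTheory Filter Set
open scoped ENNReal

namespace PerturbedLattice

/-- A dyadic scale `2 ^ k` together with a shift of the partition of `ℤ` into blocks of that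
length. -/
def ScaleShift : Type := Σ k : ℕ, ZMod (2 ^ k)

instance : MeasurableSpace ScaleShift := ⊤

instance : DiscreteMeasurableSpace ScaleShift := ⟨fun _ => trivial⟩

/-- The measure giving mass `g k` to each of the `2 ^ k` shifts at scale `2 ^ k`. -/
noncomputable def shiftMeasure (g : ℕ → ℝ≥0∞) : Measure ScaleShift :=
  Measure.sum fun s : ScaleShift => g s.1 • Measure.dirac s

/-- The displacement moving `x` to the left end of its block. -/
def displacement (x : ℤ) (s : ScaleShift) : ℝ :=
  -((((x : ZMod (2 ^ s.1)) + s.2).val : ℕ) : ℝ)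

/-- Translation of the block partition by `z`. -/
def translate (z : ℤ) : ScaleShift ≃ ScaleShift :=
  Equiv.sigmaCongrRight fun k => Equiv.addLeft (z : ZMod (2 ^ k))

/-- The number of points of the perturbed lattice, shifted by `u`, in `[-r, r]`. -/
noncomputable def pointCount (r : ℝ) (s : ScaleShift) (u : ℝ) : ℝ :=
  ∑' x : ℤ, if |(x : ℝ) + displacement x s + u| ≤ r then (1 : ℝ) else 0

lemma lintegral_shiftMeasure (g : ℕ → ℝ≥0∞) (F : ScaleShift → ℝ≥0∞) :
    ∫⁻ s, F s ∂(shiftMeasure g) = ∑' s : ScaleShift, g s.1 * F s := by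
  simp [shiftMeasure, lintegral_sum_measure, lintegral_smul_measure]

lemma lintegral_shiftMeasure_scale (g F : ℕ → ℝ≥0∞) :
    ∫⁻ s, F s.1 ∂(shiftMeasure g) = ∑' k, 2 ^ k * (g k * F k) := by
  rw [lintegral_shiftMeasure]
  refine (ENNReal.tsum_sigma' (β := fun k : ℕ => ZMod (2 ^ k)) fun s => g s.1 * F s.1).trans ?_
  refine tsum_congr fun k => ?_
  rw [tsum_fintype]
  simp [ZMod.card]

lemma map_translate_shiftMeasure (g : ℕ → ℝ≥0∞) (z : ℤ) :
    (shiftMeasure g).map (translate z) = shiftMeasure g := by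
  have h : Measurable (translate z) := measurable_from_top
  ext t ht
  rw [← lintegral_indicator_one ht, ← lintegral_indicator_one ht,
    lintegral_map (measurable_one.indicator ht) h, lintegral_shiftMeasure, lintegral_shiftMeasure]
  exact (translate z).tsum_eq fun s => g s.1 * t.indicator 1 s

lemma displacement_translate (x z : ℤ) (s : ScaleShift) :
    displacement x (translate z s) = displacement (x + z) s := by
  obtain ⟨k, v⟩ := s
  change -(((x : ZMod (2 ^ k)) + (z + v)).val : ℝ) = -((((x + z : ℤ) : ZMod (2 ^ k)) + v).val : ℝ)
  rw [Int.cast_add, add_assoc]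

lemma map_displacement_add (g : ℕ → ℝ≥0∞) (z : ℤ) :
    (shiftMeasure g).map (fun s (x : ℤ) => displacement (x + z) s) =
      (shiftMeasure g).map fun s (x : ℤ) => displacement x s := by
  conv_rhs => rw [← map_translate_shiftMeasure g z]
  rw [Measure.map_map measurable_from_top measurable_from_top]
  congr 1
  ext s x
  exact (displacement_translate x z s).symm

lemma abs_displacement_le (x : ℤ) (s : ScaleShift) : |displacement x s| ≤ 2 ^ s.1 := by
  rw [displacement, abs_neg, Nat.abs_cast]
  exact_mod_cast (ZMod.val_lt _).le

/-- The mass of `M` consecutive shifts at scale `2 ^ k`. -/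
lemma le_shiftMeasure_image (g : ℕ → ℝ≥0∞) {k M a : ℕ} (h : a + M ≤ 2 ^ k) :
    M * g k ≤ shiftMeasure g ((fun v : ℕ => (⟨k, (v : ZMod (2 ^ k))⟩ : ScaleShift)) ''
      Set.Ico a (a + M)) := by
  classical
  set f : ℕ → ScaleShift := fun v => ⟨k, (v : ZMod (2 ^ k))⟩ with hf
  have hinj : Set.InjOn f (Finset.Ico a (a + M)) := by
    intro v hv w hw hvw
    simp only [Finset.coe_Ico, Set.mem_Ico] at hv hw
    have h1 : (v : ZMod (2 ^ k)) = w := eq_of_heq (Sigma.mk.inj hvw).2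
    have h2 := congrArg ZMod.val h1
    rwa [ZMod.val_cast_of_lt (by omega), ZMod.val_cast_of_lt (by omega)] at h2
  rw [← lintegral_indicator_one (.of_discrete), lintegral_shiftMeasure]
  refine le_trans ?_ (ENNReal.sum_le_tsum ((Finset.Ico a (a + M)).image f))
  rw [Finset.sum_image hinj, Finset.sum_congr rfl (g := fun _ => g k)]
  · simp
  · intro v hv
    rw [Set.indicator_of_mem (Set.mem_image_of_mem f (by simpa using hv))]
    simp [hf]

lemma summable_pointCount (r : ℝ) (s : ScaleShift) (u : ℝ) :
    Summable fun x : ℤ => if |(x : ℝ) + displacement x s + u| ≤ r then (1 : ℝ) else 0 := by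
  refine summable_of_hasFiniteSupport ((Set.finite_Icc ⌊-(r + 2 ^ s.1 + |u|)⌋
    ⌈r + 2 ^ s.1 + |u|⌉).subset fun x hx => ?_)
  have hx' : |(x : ℝ) + displacement x s + u| ≤ r := by
    by_contra h
    simp [h] at hx
  have h1 := abs_le.1 (abs_displacement_le x s)
  have h2 := abs_le.1 hx'
  have h3 := neg_abs_le u
  have h4 := le_abs_self u
  constructor
  · exact Int.cast_le.1 ((Int.floor_le _).trans (by linarith : _ ≤ (x : ℝ)))
  · exact Int.cast_le.1 ((by linarith : (x : ℝ) ≤ _).trans (Int.le_ceil _))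

lemma le_pointCount {k v : ℕ} {r u : ℝ} (hr : |u - v| ≤ r) :
    2 ^ k ≤ pointCount r ⟨k, v⟩ u := by
  refine le_trans ?_ ((summable_pointCount r ⟨k, v⟩ u).sum_le_tsum
    (Finset.Ico (-(v : ℤ)) (-v + 2 ^ k)) fun x _ => by split_ifs <;> norm_num)
  rw [Finset.sum_congr rfl (g := fun _ => (1 : ℝ))]
  · have : ((2 : ℤ) ^ k).toNat = 2 ^ k := by exact_mod_cast Int.toNat_natCast (2 ^ k)
    simp [this]
  · intro x hx
    rw [Finset.mem_Ico] at hx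
    obtain ⟨y, hy⟩ : ∃ y : ℕ, x + v = y := Int.eq_ofNat_of_zero_le (by linarith)
    have hy' : y < 2 ^ k := by zify; linarith
    have hcast : (x : ZMod (2 ^ k)) + v = y := by
      simpa using congrArg (Int.cast (R := ZMod (2 ^ k))) hy
    have hyr : (x : ℝ) + v = y := by exact_mod_cast hy
    rw [if_pos]
    simp only [displacement, hcast, ZMod.val_cast_of_lt hy']
    convert hr using 2
    linarith

lemma pointCount_eq_zero {k v : ℕ} {r u : ℝ} (hu0 : 0 ≤ u) (hu1 : u < 1)
    (hv : r + 1 < v) (hv' : v + r < 2 ^ k) : pointCount r ⟨k, v⟩ u = 0 := by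
  refine (tsum_congr fun x => if_neg ?_).trans tsum_zero
  simp only [displacement]
  set n : ℕ := ((x : ZMod (2 ^ k)) + v).val with hn
  obtain ⟨j, hj⟩ : ((2 ^ k : ℕ) : ℤ) ∣ x + v - n := by
    rw [← ZMod.intCast_zmod_eq_zero_iff_dvd]
    simp [hn]
  have hj' : (x : ℝ) + v - n = 2 ^ k * j := by exact_mod_cast congrArg (Int.cast (R := ℝ)) hj
  have hpos : (0 : ℝ) < 2 ^ k := by positivity
  intro h
  rw [abs_le] at h
  rcases le_or_gt j 0 with hj0 | hj0
  · have : (j : ℝ) ≤ 0 := by exact_mod_cast hj0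
    nlinarith
  · have : (1 : ℝ) ≤ j := by exact_mod_cast hj0
    nlinarith

lemma le_evariance_of_two_values {Ω : Type*} [MeasurableSpace Ω] {P : Measure Ω} {X : Ω → ℝ}
    {A B : Set Ω} (hA : MeasurableSet A) (hB : MeasurableSet B) {l : ℝ} {q : ℝ≥0∞}
    (hXA : ∀ ω ∈ A, X ω = 0) (hXB : ∀ ω ∈ B, l ≤ X ω)
    (hPA : q ≤ P A) (hPB : q ≤ P B) :
    ENNReal.ofReal (l / 2) ^ 2 * q ≤ evariance X P := by
  have key : ∀ S : Set Ω, MeasurableSet S → q ≤ P S → (∀ ω ∈ S, l / 2 ≤ |X ω - P[X]|) →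
      ENNReal.ofReal (l / 2) ^ 2 * q ≤ evariance X P := by
    intro S hS hPS h
    calc ENNReal.ofReal (l / 2) ^ 2 * q ≤ ENNReal.ofReal (l / 2) ^ 2 * P S := by gcongr
      _ = ∫⁻ _ in S, ENNReal.ofReal (l / 2) ^ 2 ∂P := by rw [setLIntegral_const]
      _ ≤ ∫⁻ ω in S, ‖X ω - P[X]‖ₑ ^ 2 ∂P := by
          refine setLIntegral_mono' hS fun ω hω => ?_
          rw [Real.enorm_eq_ofReal_abs]
          gcongr
          exact h ω hω
      _ ≤ evariance X P := setLIntegral_le_lintegral _ _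
  rcases le_total (l / 2) P[X] with hm | hm
  · refine key A hA hPA fun ω hω => ?_
    rw [hXA ω hω, zero_sub, abs_neg]
    exact hm.trans (le_abs_self _)
  · refine key B hB hPB fun ω hω => le_trans ?_ (le_abs_self _)
    linarith [hXB ω hω]

/-- The joint law of the block partition and an independent uniform shift in `[0, 1)`. -/
noncomputable def jointLaw (g : ℕ → ℝ≥0∞) : Measure (ScaleShift × ℝ) :=
  (shiftMeasure g).prod (volume.restrict (Set.Ico (0 : ℝ) 1))

instance : IsProbabilityMeasure (volume.restrict (Set.Ico (0 : ℝ) 1)) := ⟨by simp⟩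

lemma le_evariance_pointCount (g : ℕ → ℝ≥0∞) {j : ℕ} {r : ℝ} (hr : 1 ≤ r) (hjr : 2 ^ j ≤ r)
    (hrj : r < 2 ^ (j + 1)) :
    ENNReal.ofReal (2 ^ (j + 4) / 2) ^ 2 * (2 ^ j * g (j + 4)) ≤
      evariance (fun ω : ScaleShift × ℝ => pointCount r ω.1 ω.2) (jointLaw g) := by
  set f : ℕ → ScaleShift := fun v => ⟨j + 4, (v : ZMod (2 ^ (j + 4)))⟩ with hf
  have hM : (1 : ℝ) ≤ 2 ^ j := one_le_pow₀ one_le_two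
  have hmeas : ∀ a, MeasurableSet ((f '' Set.Ico a (a + 2 ^ j)) ×ˢ Set.Ico (0 : ℝ) 1) :=
    fun a => MeasurableSet.prod .of_discrete measurableSet_Ico
  have hmass : ∀ a, a + 2 ^ j ≤ 2 ^ (j + 4) →
      2 ^ j * g (j + 4) ≤ jointLaw g ((f '' Set.Ico a (a + 2 ^ j)) ×ˢ Set.Ico (0 : ℝ) 1) := by
    intro a ha
    rw [jointLaw, Measure.prod_prod]
    simpa using le_shiftMeasure_image g ha
  refine le_evariance_of_two_values (hmeas (8 * 2 ^ j)) (hmeas 0) ?_ ?_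
    (hmass _ (by rw [pow_add]; omega)) (hmass _ (by rw [pow_add]; omega))
  · rintro ⟨_, u⟩ ⟨⟨v, ⟨hv, hv'⟩, rfl⟩, hu⟩
    have h1 : (8 : ℝ) * 2 ^ j ≤ v := by exact_mod_cast hv
    have h2 : (v : ℝ) < 8 * 2 ^ j + 2 ^ j := by exact_mod_cast hv'
    refine pointCount_eq_zero hu.1 hu.2 ?_ ?_ <;> rw [pow_succ] at hrj
    · linarith
    · rw [pow_add]; linarith
  · rintro ⟨_, u⟩ ⟨⟨v, ⟨-, hv⟩, rfl⟩, hu0, hu1⟩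
    rw [zero_add] at hv
    have h1 : (v : ℝ) < 2 ^ j := by exact_mod_cast hv
    refine le_pointCount ?_
    simp only at hu0 hu1
    rw [abs_le]
    constructor <;> linarith [(Nat.cast_nonneg v : (0 : ℝ) ≤ v)]

/-- The ratio of the geometric law of the scale. -/
noncomputable def ratio (ε : ℝ) : ℝ := 2 ^ (-(2 - ε / 2))

/-- The mass of a single shift at scale `2 ^ k`. -/
noncomputable def weight (ε : ℝ) (k : ℕ) : ℝ≥0∞ :=
  ENNReal.ofReal ((1 - ratio ε) * (ratio ε / 2) ^ k)

lemma ratio_pos (ε : ℝ) : 0 < ratio ε := Real.rpow_pos_of_pos two_pos _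

lemma ratio_lt_one {ε : ℝ} (hε : ε < 1) : ratio ε < 1 :=
  Real.rpow_lt_one_of_one_lt_of_neg one_lt_two (by linarith)

lemma two_pow_mul_weight {ε b : ℝ} (hε : ε < 1) (k : ℕ) :
    2 ^ k * (weight ε k * ENNReal.ofReal (b ^ k)) =
      ENNReal.ofReal ((1 - ratio ε) * (ratio ε * b) ^ k) := by
  have h1 := ratio_pos ε
  have h2 := ratio_lt_one hε
  have h3 : 0 ≤ 1 - ratio ε := by linarith
  have : (2 : ℝ≥0∞) ^ k = ENNReal.ofReal (2 ^ k) := by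
    rw [ENNReal.ofReal_pow two_pos.le, ENNReal.ofReal_ofNat]
  rw [this, weight, ← ENNReal.ofReal_mul (by positivity), ← ENNReal.ofReal_mul (by positivity)]
  congr 1
  rw [div_pow, mul_pow]
  field_simp

lemma tsum_two_pow_mul_weight {ε b : ℝ} (hε : ε < 1) (hb : 0 ≤ b) (hb1 : ratio ε * b < 1) :
    ∑' k, 2 ^ k * (weight ε k * ENNReal.ofReal (b ^ k)) =
      ENNReal.ofReal ((1 - ratio ε) * (1 - ratio ε * b)⁻¹) := by
  have h1 := ratio_pos ε
  have h3 : 0 ≤ 1 - ratio ε := by linarith [ratio_lt_one hε]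
  simp_rw [two_pow_mul_weight hε]
  rw [← ENNReal.ofReal_tsum_of_nonneg (fun k => by positivity)
    ((summable_geometric_of_lt_one (by positivity) hb1).mul_left _), tsum_mul_left,
    tsum_geometric_of_lt_one (by positivity) hb1]

lemma isProbabilityMeasure_shiftMeasure {ε : ℝ} (hε : ε < 1) :
    IsProbabilityMeasure (shiftMeasure (weight ε)) := by
  constructor
  have h := ratio_lt_one hε
  have := lintegral_shiftMeasure_scale (weight ε) fun k => ENNReal.ofReal (1 ^ k)
  rw [tsum_two_pow_mul_weight hε zero_le_one (by simpa using h), mul_one,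
    mul_inv_cancel₀ (by linarith)] at this
  simpa using this

lemma integrable_displacement {ε : ℝ} (hε0 : 0 < ε) (hε : ε < 1) :
    Integrable (fun s => |displacement 0 s| ^ (2 - ε)) (shiftMeasure (weight ε)) := by
  refine ⟨measurable_from_top.aestronglyMeasurable, ?_⟩
  have hb1 : ratio ε * (2 : ℝ) ^ (2 - ε) < 1 := by
    rw [ratio, ← Real.rpow_add two_pos]
    exact Real.rpow_lt_one_of_one_lt_of_neg one_lt_two (by linarith)
  have h := lintegral_shiftMeasure_scale (weight ε) fun k => ENNReal.ofReal (((2 : ℝ) ^ (2 - ε)) ^ k)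
  rw [tsum_two_pow_mul_weight hε (by positivity) hb1] at h
  refine lt_of_le_of_lt (lintegral_mono fun s => ?_) (h.trans_lt ENNReal.ofReal_lt_top)
  rw [Real.enorm_eq_ofReal (by positivity)]
  refine ENNReal.ofReal_le_ofReal ?_
  calc |displacement 0 s| ^ (2 - ε) ≤ ((2 : ℝ) ^ s.1) ^ (2 - ε) :=
        Real.rpow_le_rpow (abs_nonneg _) (abs_displacement_le 0 s) (by linarith)
    _ = ((2 : ℝ) ^ (2 - ε)) ^ s.1 := by
        rw [← Real.rpow_natCast, ← Real.rpow_natCast, ← Real.rpow_mul two_pos.le,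
          ← Real.rpow_mul two_pos.le, mul_comm]

lemma rpow_le_evariance_pointCount {ε r : ℝ} (hε0 : 0 < ε) (hε : ε < 1) (hr : 1 ≤ r) :
    ENNReal.ofReal ((1 - ratio ε) / 64 * r ^ (ε / 2)) ≤
      evariance (fun ω : ScaleShift × ℝ => pointCount r ω.1 ω.2) (jointLaw (weight ε)) := by
  obtain ⟨j, hjr, hrj⟩ := exists_nat_pow_near hr one_lt_two
  refine le_trans ?_ (le_evariance_pointCount (weight ε) hr hjr hrj)
  have h1 := ratio_pos ε
  have h3 : 0 ≤ 1 - ratio ε := by linarith [ratio_lt_one hε]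
  have hpow : (2 : ℝ≥0∞) ^ j = ENNReal.ofReal (2 ^ j) := by
    rw [ENNReal.ofReal_pow two_pos.le, ENNReal.ofReal_ofNat]
  rw [hpow, weight, ← ENNReal.ofReal_pow (by positivity), ← ENNReal.ofReal_mul (by positivity),
    ← ENNReal.ofReal_mul (by positivity)]
  refine ENNReal.ofReal_le_ofReal ?_
  have hscale : (4 * ratio ε) ^ (j + 4) = ((2 : ℝ) ^ (j + 4)) ^ (ε / 2) := by
    have : 4 * ratio ε = (2 : ℝ) ^ (ε / 2) := by
      rw [ratio, show (4 : ℝ) = 2 ^ (2 : ℝ) by norm_num, ← Real.rpow_add two_pos]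
      congr 1
      ring
    rw [this, ← Real.rpow_natCast, ← Real.rpow_natCast, ← Real.rpow_mul two_pos.le,
      ← Real.rpow_mul two_pos.le, mul_comm]
  have hle : r ^ (ε / 2) ≤ (4 * ratio ε) ^ (j + 4) := by
    rw [hscale]
    refine Real.rpow_le_rpow (by linarith) (hrj.le.trans ?_) (by linarith)
    exact pow_le_pow_right₀ one_le_two (by omega)
  calc (1 - ratio ε) / 64 * r ^ (ε / 2)
      ≤ (1 - ratio ε) / 64 * (4 * ratio ε) ^ (j + 4) := by gcongr
    _ = (2 ^ (j + 4) / 2) ^ 2 * (2 ^ j * ((1 - ratio ε) * (ratio ε / 2) ^ (j + 4))) := by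
        have h4 : (4 : ℝ) ^ (j + 4) = 2 ^ (j + 4) * 2 ^ (j + 4) := by
          rw [← mul_pow]; norm_num
        rw [mul_pow, div_pow (ratio ε), h4]
        field_simp
        ring

end PerturbedLattice

open PerturbedLattice

/-- Sharpness of the second-moment condition for class-I hyperuniformity in
dimension 1: for every `ε ∈ (0,1)` there is a perturbed lattice whose ℤ-invariant
perturbations satisfy `E[|p_0|^{2−ε}] < ∞`, yet `Var[N_r]/(2r) ≥ c·r^{−1+ε/2}` for all
`r ≥ 1`. -/
theorem sharpness_of_second_moment_condition_dim_one
    (ε : ℝ) (hε0 : 0 < ε) (hε1 : ε < 1) :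
    ∃ (Ω : Type) (m : MeasurableSpace Ω) (P : Measure Ω), IsProbabilityMeasure P ∧
    ∃ (p : ℤ → Ω → ℝ) (U : Ω → ℝ) (c : ℝ),
      0 < c ∧
      (∀ x, Measurable (p x)) ∧
      (∀ z : ℤ,
        Measure.map (fun ω => fun x : ℤ => p (x + z) ω) P
          = Measure.map (fun ω => fun x : ℤ => p x ω) P) ∧
      Measurable U ∧
      Measure.map U P = volume.restrict (Set.Ico (0:ℝ) 1) ∧
      IndepFun U (fun ω => fun x : ℤ => p x ω) P ∧
      Integrable (fun ω => |p 0 ω| ^ (2 - ε)) P ∧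
      ∀ r : ℝ, 1 ≤ r →
        ENNReal.ofReal (c * r ^ (-1 + ε / 2)) ≤
          evariance (fun ω => ∑' x : ℤ,
              (if |(x : ℝ) + p x ω + U ω| ≤ r then (1 : ℝ) else 0)) P
            / ENNReal.ofReal (2 * r) := by
  have := isProbabilityMeasure_shiftMeasure hε1
  have hdisp : Measurable fun s (x : ℤ) => displacement x s := measurable_from_top
  have hlaw : ∀ f : ScaleShift → ℤ → ℝ, Measure.map (fun ω : ScaleShift × ℝ => f ω.1)
      (jointLaw (weight ε)) = (shiftMeasure (weight ε)).map f := by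
    intro f
    rw [← Function.comp_def f, ← Measure.map_map measurable_from_top measurable_fst, jointLaw,
      Measure.map_fst_prod, measure_univ, one_smul]
  have hratio := ratio_lt_one hε1
  refine ⟨ScaleShift × ℝ, inferInstance, jointLaw (weight ε), by unfold jointLaw; infer_instance,
    fun x ω => displacement x ω.1, Prod.snd, (1 - ratio ε) / 128, by linarith,
    fun x => (measurable_from_top (f := displacement x)).comp measurable_fst, fun z => ?_, measurable_snd, ?_, ?_, ?_,
    fun r hr => ?_⟩
  · rw [hlaw fun s x => displacement (x + z) s, hlaw fun s x => displacement x s,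
      map_displacement_add]
  · rw [jointLaw, Measure.map_snd_prod, measure_univ, one_smul]
  · exact (indepFun_prod hdisp measurable_id).symm
  · exact (integrable_displacement hε0 hε1).comp_fst _
  · have hr0 : 0 < r := by linarith
    have hC : 0 < 1 - ratio ε := by linarith
    rw [ENNReal.le_div_iff_mul_le (.inl (ENNReal.ofReal_pos.2 (by positivity)).ne')
      (.inl ENNReal.ofReal_ne_top), ← ENNReal.ofReal_mul (by positivity)]
    refine le_of_eq_of_le ?_ (rpow_le_evariance_pointCount hε0 hε1 hr)
    rw [Real.rpow_add hr0, Real.rpow_neg_one]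
    congr 1
    field_simp
    ring
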